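/- Let n ≥ 1, k > 0, δ > 0, g₁ > 0, and suppose there exist positive constants χ, λ₀, λ₁ such that Φ₀ is positive definite, Ψ₁ = −k + (1 + k²n)χ ≤ 0, and Ψ₂ is negative semidefinite. Then every classical (C²) solution e : Ω × [t₀, t₁] → ℝ of the backward error system — i.e., e_tt = Δe + g(x,t)e on Ω × (t₀,t₁) with g continuous, |g| ≤ g₁, e = 0 on Γ_D, and e_{x_p} = +k e_t on each face {x_p = 1} — satisfies, for all t ∈ [t₀, t₁], ∫_Ω (|∇e(x,t₀)|² + e_t(x,t₀)²) dx ≤ (β/α) e^{−2δ(t−t₀)} ∫_Ω (|∇e(x,t)|² + e_t(x,t)²) dx, where α = 2λ_min(Φ₀) and β = 2(1 + 4/(π²n))λ_max(Φ₁) + χk(n−1) with Φ₁ = Φ₀ + diag(4λ₀/(π²n), 0, 0). -/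

import Mathlib

open MeasureTheory Real Matrix

noncomputable section

/-- The closed unit hypercube `[0,1]^n`. -/
def cube (n : ℕ) : Set (Fin n → ℝ) := Set.univ.pi fun _ => Set.Icc (0:ℝ) 1

/-- Partial derivative of `u` in the `p`-th coordinate direction. -/
def pd {n : ℕ} (p : Fin n) (u : (Fin n → ℝ) → ℝ) (x : Fin n → ℝ) : ℝ :=
  fderiv ℝ u x (Pi.single p 1)

/-- Squared Euclidean norm of the gradient, `|∇u|²`. -/
def gradSq {n : ℕ} (u : (Fin n → ℝ) → ℝ) (x : Fin n → ℝ) : ℝ := ∑ p, (pd p u x) ^ 2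

/-- Laplacian `Δu = Σ_p u_{x_p x_p}`. -/
def lap {n : ℕ} (u : (Fin n → ℝ) → ℝ) (x : Fin n → ℝ) : ℝ := ∑ p, pd p (pd p u) x

/-- Surface integral over `Γ_N`: `Σ_p ∫_{[0,1]^{n-1}} h|_{x_p = 1} dx'`
(each face integral realized as an integral over the cube of a function
independent of the `p`-th coordinate). -/
def faceInt {n : ℕ} (h : (Fin n → ℝ) → ℝ) : ℝ :=
  ∑ p : Fin n, ∫ x in cube n, h (Function.update x p 1)

/-- `xᵀ∇u`. -/
def xGrad {n : ℕ} (u : (Fin n → ℝ) → ℝ) (x : Fin n → ℝ) : ℝ := ∑ p, x p * pd p u x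

/-- Minimal eigenvalue of a symmetric matrix, via the Rayleigh quotient. -/
def lamMin (M : Matrix (Fin 3) (Fin 3) ℝ) : ℝ :=
  sInf {r | ∃ v : Fin 3 → ℝ, (∑ i, (v i) ^ 2) = 1 ∧ r = v ⬝ᵥ M.mulVec v}

/-- Maximal eigenvalue of a symmetric matrix, via the Rayleigh quotient. -/
def lamMax (M : Matrix (Fin 3) (Fin 3) ℝ) : ℝ :=
  sSup {r | ∃ v : Fin 3 → ℝ, (∑ i, (v i) ^ 2) = 1 ∧ r = v ⬝ᵥ M.mulVec v}

/-- Negative definiteness. -/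
def NegDefM {m : ℕ} (M : Matrix (Fin m) (Fin m) ℝ) : Prop := (-M).PosDef

/-- Negative semidefiniteness. -/
def NegSemidefM {m : ℕ} (M : Matrix (Fin m) (Fin m) ℝ) : Prop := (-M).PosSemidef

/-- The matrix `Φ₀` of LMI (12). -/
def Phi0 (n : ℕ) (χ lam0 : ℝ) : Matrix (Fin 3) (Fin 3) ℝ :=
  !![1/2 - 4*lam0/(π^2*n), Real.sqrt n * χ, 0;
     Real.sqrt n * χ, 1/2, ((n:ℝ)-1)*χ/2;
     0, ((n:ℝ)-1)*χ/2, lam0]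

/-- `Φ₁ = Φ₀ + diag(4λ₀/(π²n), 0, 0)`. -/
def Phi1 (n : ℕ) (χ lam0 : ℝ) : Matrix (Fin 3) (Fin 3) ℝ :=
  Phi0 n χ lam0 + Matrix.diagonal ![4*lam0/(π^2*n), 0, 0]

/-- The matrix `Ψ₂` of LMI (14). -/
def Psi2 (n : ℕ) (k χ δ g1 lam1 : ℝ) : Matrix (Fin 3) (Fin 3) ℝ :=
  !![-χ + δ*(1 + χ*k*((n:ℝ)-1)) + 4*lam1/(π^2*n), 2*δ*Real.sqrt n*χ, Real.sqrt n*g1*χ;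
     2*δ*Real.sqrt n*χ, -χ + δ, g1/2 + δ*((n:ℝ)-1)*χ;
     Real.sqrt n*g1*χ, g1/2 + δ*((n:ℝ)-1)*χ, -lam1 + g1*((n:ℝ)-1)*χ]

/-- The matrix `Φ` of the exact-observability LMI (32), with `σ = e^{-2δT*}`. -/
def PhiM (n : ℕ) (χ σ lam2 : ℝ) : Matrix (Fin 3) (Fin 3) ℝ :=
  !![-(1-σ)/2 + 4*lam2/(π^2*n), Real.sqrt n*(1+σ)*χ, 0;
     Real.sqrt n*(1+σ)*χ, -(1-σ)/2, ((n:ℝ)-1)*(1+σ)*χ/2;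
     0, ((n:ℝ)-1)*(1+σ)*χ/2, -lam2]

/-- `α = 2λ_min(Φ₀)`. -/
def alphaC (n : ℕ) (χ lam0 : ℝ) : ℝ := 2 * lamMin (Phi0 n χ lam0)

/-- `β = 2(1 + 4/(π²n))λ_max(Φ₁) + χk(n−1)`. -/
def betaC (n : ℕ) (k χ lam0 : ℝ) : ℝ :=
  2 * (1 + 4/(π^2*n)) * lamMax (Phi1 n χ lam0) + χ*k*((n:ℝ)-1)

open Set Function

section CubeIntegrals

variable {n : ℕ}

lemma isCompact_cube : IsCompact (cube n) := isCompact_univ_pi fun _ => isCompact_Icc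

lemma update_mem_cube {x : Fin n → ℝ} (hx : x ∈ cube n) (p : Fin n) {s : ℝ}
    (hs : s ∈ Icc (0:ℝ) 1) : update x p s ∈ cube n := by
  intro q _
  by_cases h : q = p
  · subst h; simpa using hs
  · simpa [h] using hx q (mem_univ q)

lemma volume_restrict_cube :
    (volume : Measure (Fin n → ℝ)).restrict (cube n) =
      Measure.pi fun _ : Fin n => (volume : Measure ℝ).restrict (Icc 0 1) := by
  rw [volume_pi, cube, Measure.restrict_pi_pi]

instance : IsProbabilityMeasure ((volume : Measure ℝ).restrict (Icc 0 1)) :=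
  ⟨by simp⟩

lemma measurePreserving_update_cube (p : Fin n) :
    MeasurePreserving (fun y : (Fin n → ℝ) × ℝ => update y.1 p y.2)
      ((volume.restrict (cube n)).prod (volume.restrict (Icc 0 1)))
      (volume.restrict (cube n)) := by
  have hm : Measurable (fun y : (Fin n → ℝ) × ℝ => update y.1 p y.2) :=
    (Continuous.update continuous_fst p continuous_snd).measurable
  refine ⟨hm, ?_⟩
  rw [volume_restrict_cube]
  refine (Measure.pi_eq fun s hs => ?_).symm
  rw [Measure.map_apply hm (MeasurableSet.univ_pi hs)]
  have : (fun y : (Fin n → ℝ) × ℝ => update y.1 p y.2) ⁻¹' (univ.pi s)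
      = (univ.pi (update s p univ)) ×ˢ s p := by
    ext ⟨x, t⟩
    simp only [mem_preimage, mem_pi, mem_univ, true_implies, mem_prod]
    constructor
    · intro h
      refine ⟨fun q => ?_, by simpa using h p⟩
      by_cases hq : q = p
      · subst hq; simp
      · simpa [hq] using h q
    · rintro ⟨h, h'⟩ q
      by_cases hq : q = p
      · subst hq; simpa using h'
      · simpa [hq] using h q
  rw [this, Measure.prod_prod, Measure.pi_pi,
    ← Finset.mul_prod_erase Finset.univ _ (Finset.mem_univ p),
    ← Finset.mul_prod_erase Finset.univ (fun i => (volume.restrict (Icc 0 1)) (s i))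
      (Finset.mem_univ p), update_self, measure_univ, one_mul, mul_comm]
  congr 1
  refine Finset.prod_congr rfl fun q hq => ?_
  rw [update_of_ne (Finset.ne_of_mem_erase hq)]

lemma integrableOn_cube {H : (Fin n → ℝ) → ℝ} (hH : Continuous H) :
    Integrable H (volume.restrict (cube n)) :=
  hH.continuousOn.integrableOn_compact isCompact_cube

lemma integral_cube_eq_integral_line {H : (Fin n → ℝ) → ℝ} (hH : Continuous H) (p : Fin n) :
    ∫ x in cube n, H x = ∫ x in cube n, ∫ s in (0:ℝ)..1, H (update x p s) := by
  have hmp := measurePreserving_update_cube p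
  rw [← hmp.map_eq, integral_map hmp.measurable.aemeasurable
    hH.aestronglyMeasurable, hmp.map_eq, integral_prod]
  · refine integral_congr_ae (Filter.Eventually.of_forall fun x => ?_)
    simp only
    rw [intervalIntegral.integral_of_le zero_le_one, integral_Icc_eq_integral_Ioc]
  · exact (hmp.integrable_comp hH.aestronglyMeasurable).2 (integrableOn_cube hH)

lemma integral_cube_mono {G H : (Fin n → ℝ) → ℝ} (hG : Continuous G) (hH : Continuous H)
    (h : ∀ x ∈ cube n, G x ≤ H x) : ∫ x in cube n, G x ≤ ∫ x in cube n, H x :=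
  setIntegral_mono_on (integrableOn_cube hG) (integrableOn_cube hH)
    isCompact_cube.measurableSet h

lemma continuous_integral_line {H : (Fin n → ℝ) → ℝ} (hH : Continuous H) (p : Fin n) :
    Continuous fun x => ∫ s in (0:ℝ)..1, H (update x p s) :=
  intervalIntegral.continuous_parametric_intervalIntegral_of_continuous'
    (f := fun x s => H (update x p s))
    (hH.comp (Continuous.update continuous_fst p continuous_snd)) 0 1

/-- The fundamental theorem of calculus in one coordinate, integrated over the cube. -/
lemma integral_cube_lineDeriv {F F' : (Fin n → ℝ) → ℝ} (p : Fin n) (hF' : Continuous F')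
    (hd : ∀ x, HasDerivAt (fun s => F (update x p s)) (F' x) (x p)) :
    ∫ x in cube n, F' x = ∫ x in cube n, (F (update x p 1) - F (update x p 0)) := by
  rw [integral_cube_eq_integral_line hF' p]
  refine integral_congr_ae (Filter.Eventually.of_forall fun x => ?_)
  refine intervalIntegral.integral_eq_sub_of_hasDerivAt (f := fun s => F (update x p s))
    (fun s _ => ?_) ?_
  · simpa using hd (update x p s)
  · exact (hF'.comp (continuous_const.update p continuous_id)).intervalIntegrable _ _

lemma hasDerivAt_integral_cube {F F' : ℝ → (Fin n → ℝ) → ℝ}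
    (hF : ∀ t, Continuous (F t)) (hF' : Continuous fun q : ℝ × (Fin n → ℝ) => F' q.1 q.2)
    (hd : ∀ t x, HasDerivAt (fun s => F s x) (F' t x) t) (t : ℝ) :
    HasDerivAt (fun s => ∫ x in cube n, F s x) (∫ x in cube n, F' t x) t := by
  obtain ⟨C, hC⟩ := ((isCompact_Icc (a := t - 1) (b := t + 1)).prod
    (isCompact_cube (n := n))).exists_bound_of_continuousOn hF'.continuousOn
  refine (hasDerivAt_integral_of_dominated_loc_of_deriv_le (bound := fun _ => C)
    (Icc_mem_nhds (sub_one_lt t) (lt_add_one t))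
    (Filter.Eventually.of_forall fun s => (hF s).aestronglyMeasurable)
    (integrableOn_cube (hF t)) (F' := F') ?_ ?_ (integrableOn_cube continuous_const) ?_).2
  · exact (hF'.comp (Continuous.prodMk_right t)).aestronglyMeasurable
  · refine (ae_restrict_iff' isCompact_cube.measurableSet).2
      (Filter.Eventually.of_forall fun x hx s hs => hC (s, x) ⟨hs, hx⟩)
  · exact Filter.Eventually.of_forall fun x s _ => hd s x

end CubeIntegrals

section Poincare

/-- Wirtinger's inequality on `[0,1]` with one Dirichlet end, for every subcritical constant. -/
lemma integral_sq_le_integral_deriv_sq_of_lt {f f' : ℝ → ℝ} (hf' : Continuous f')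
    (hd : ∀ s, HasDerivAt f (f' s) s) (h0 : f 0 = 0) {c : ℝ} (hc0 : 0 ≤ c) (hc : c < π / 2) :
    c ^ 2 * ∫ s in (0:ℝ)..1, f s ^ 2 ≤ ∫ s in (0:ℝ)..1, f' s ^ 2 := by
  have hf : Continuous f := continuous_iff_continuousAt.2 fun s => (hd s).continuousAt
  have hcos : ∀ s ∈ Icc (0:ℝ) 1, cos (c * (1 - s)) ≠ 0 := fun s hs =>
    (cos_pos_of_mem_Ioo ⟨by nlinarith [pi_pos, mul_nonneg hc0 (sub_nonneg.2 hs.2)],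
      by nlinarith [mul_nonneg hc0 hs.1]⟩).ne'
  have htan : ContinuousOn (fun s => tan (c * (1 - s))) (Icc 0 1) := by
    simp_rw [tan_eq_sin_div_cos]
    exact ContinuousOn.div (by fun_prop) (by fun_prop) hcos
  have hder : ∀ s ∈ uIcc (0:ℝ) 1, HasDerivAt (fun s => c * tan (c * (1 - s)) * f s ^ 2)
      (-(c ^ 2 * (1 + tan (c * (1 - s)) ^ 2)) * f s ^ 2
        + c * tan (c * (1 - s)) * (2 * f s * f' s)) s := by
    intro s hs
    rw [uIcc_of_le zero_le_one] at hs
    have h1 : HasDerivAt (fun s : ℝ => c * (1 - s)) (-c) s := by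
      simpa using ((hasDerivAt_id s).const_sub 1).const_mul c
    have h2 := (((hasDerivAt_tan (hcos s hs)).comp s h1).const_mul c).mul ((hd s).pow 2)
    refine h2.congr_deriv ?_
    have := hcos s hs
    simp only [Function.comp, Nat.cast_ofNat, Pi.pow_apply, Nat.add_one_sub_one, pow_one]
    rw [← Real.inv_one_add_tan_sq this]
    have h3 : 1 + tan (c * (1 - s)) ^ 2 ≠ 0 := by positivity
    field_simp
  have hcont : ContinuousOn (fun s => -(c ^ 2 * (1 + tan (c * (1 - s)) ^ 2)) * f s ^ 2
        + c * tan (c * (1 - s)) * (2 * f s * f' s)) (Icc 0 1) := by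
    fun_prop
  have hcont' : IntervalIntegrable (fun s => -(c ^ 2 * (1 + tan (c * (1 - s)) ^ 2)) * f s ^ 2
        + c * tan (c * (1 - s)) * (2 * f s * f' s)) volume 0 1 :=
    ContinuousOn.intervalIntegrable (by rwa [uIcc_of_le zero_le_one])
  have key := intervalIntegral.integral_eq_sub_of_hasDerivAt hder hcont'
  simp only [h0, sub_self, mul_zero, tan_zero] at key
  have i1 : IntervalIntegrable (fun s => c ^ 2 * f s ^ 2) volume 0 1 :=
    Continuous.intervalIntegrable (by fun_prop) _ _
  have i2 : IntervalIntegrable (fun s => f' s ^ 2) volume 0 1 :=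
    Continuous.intervalIntegrable (by fun_prop) _ _
  rw [← intervalIntegral.integral_const_mul]
  have hmono := intervalIntegral.integral_mono_on zero_le_one (i1.add hcont') i2
    (fun s _ => by
      nlinarith [sq_nonneg (f' s - c * tan (c * (1 - s)) * f s)])
  rw [intervalIntegral.integral_add i1 hcont', key] at hmono
  simpa using hmono

lemma integral_sq_le_integral_deriv_sq {f f' : ℝ → ℝ} (hf' : Continuous f')
    (hd : ∀ s, HasDerivAt f (f' s) s) (h0 : f 0 = 0) :
    (π / 2) ^ 2 * ∫ s in (0:ℝ)..1, f s ^ 2 ≤ ∫ s in (0:ℝ)..1, f' s ^ 2 := by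
  have hlim : Filter.Tendsto (fun c : ℝ => c ^ 2 * ∫ s in (0:ℝ)..1, f s ^ 2)
      (nhdsWithin (π / 2) (Iio (π / 2))) (nhds ((π / 2) ^ 2 * ∫ s in (0:ℝ)..1, f s ^ 2)) :=
    (Continuous.tendsto (by fun_prop) _).mono_left nhdsWithin_le_nhds
  refine le_of_tendsto hlim ?_
  filter_upwards [Ioo_mem_nhdsLT (by positivity : (0:ℝ) < π / 2)] with c hc
  exact integral_sq_le_integral_deriv_sq_of_lt hf' hd h0 hc.1.le hc.2

/-- Jensen's inequality in the form used for traces. -/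
lemma sq_le_integral_deriv_sq {f f' : ℝ → ℝ} (hf' : Continuous f')
    (hd : ∀ s, HasDerivAt f (f' s) s) (h0 : f 0 = 0) :
    f 1 ^ 2 ≤ ∫ s in (0:ℝ)..1, f' s ^ 2 := by
  have key := intervalIntegral.integral_eq_sub_of_hasDerivAt (fun s _ => hd s)
    (hf'.intervalIntegrable 0 1)
  rw [h0, sub_zero] at key
  have hmono := intervalIntegral.integral_mono_on (μ := volume) zero_le_one
    (f := fun s => 2 * f 1 * f' s - f 1 ^ 2) (g := fun s => f' s ^ 2)
    (Continuous.intervalIntegrable (by fun_prop) _ _)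
    (Continuous.intervalIntegrable (by fun_prop) _ _)
    (fun s _ => by nlinarith [sq_nonneg (f' s - f 1)])
  rw [intervalIntegral.integral_sub (Continuous.intervalIntegrable (by fun_prop) _ _)
    (by simp), intervalIntegral.integral_const_mul, key] at hmono
  simp at hmono
  nlinarith

end Poincare

section PartialDerivatives

variable {n : ℕ} {w v : (Fin n → ℝ) → ℝ}

lemma contDiff_pd (hw : ContDiff ℝ 2 w) (p : Fin n) : ContDiff ℝ 1 (pd p w) :=
  (hw.fderiv_right (m := 1) (by norm_num)).clm_apply contDiff_const

lemma continuous_pd (hw : ContDiff ℝ 1 w) (p : Fin n) : Continuous (pd p w) :=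
  (hw.continuous_fderiv one_ne_zero).clm_apply continuous_const

lemma hasDerivAt_pd (hw : ContDiff ℝ 1 w) (p : Fin n) (x : Fin n → ℝ) (s : ℝ) :
    HasDerivAt (fun s => w (update x p s)) (pd p w (update x p s)) s :=
  ((hw.differentiable one_ne_zero _).hasFDerivAt).comp_hasDerivAt s (hasDerivAt_update x p s)

lemma hasDerivAt_pd_self (hw : ContDiff ℝ 1 w) (p : Fin n) (x : Fin n → ℝ) :
    HasDerivAt (fun s => w (update x p s)) (pd p w x) (x p) := by
  simpa using hasDerivAt_pd hw p x (x p)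

lemma pd_comm (hw : ContDiff ℝ 2 w) (p q : Fin n) (x : Fin n → ℝ) :
    pd p (pd q w) x = pd q (pd p w) x := by
  have h2 : DifferentiableAt ℝ (fderiv ℝ w) x :=
    (hw.fderiv_right (m := 1) (by norm_num)).differentiable one_ne_zero x
  have key : ∀ p q : Fin n, pd p (pd q w) x
      = fderiv ℝ (fderiv ℝ w) x (Pi.single p 1) (Pi.single q 1) := fun p q => by
    change fderiv ℝ (fun y => fderiv ℝ w y (Pi.single q 1)) x (Pi.single p 1) = _
    rw [fderiv_clm_apply h2 (differentiableAt_const _)]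
    simp
  rw [key, key]
  exact (hw.contDiffAt.isSymmSndFDerivAt (by simp)).eq _ _

lemma continuous_gradSq (hw : ContDiff ℝ 1 w) : Continuous (gradSq w) :=
  continuous_finsetSum _ fun p _ => (continuous_pd hw p).pow 2

lemma continuous_xGrad (hw : ContDiff ℝ 1 w) : Continuous (xGrad w) :=
  continuous_finsetSum _ fun p _ => (continuous_apply p).mul (continuous_pd hw p)

lemma continuous_lap (hw : ContDiff ℝ 2 w) : Continuous (lap w) :=
  continuous_finsetSum _ fun p _ => continuous_pd (contDiff_pd hw p) p

lemma gradSq_nonneg (w : (Fin n → ℝ) → ℝ) (x : Fin n → ℝ) : 0 ≤ gradSq w x :=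
  Finset.sum_nonneg fun _ _ => sq_nonneg _

lemma xGrad_sq_le (w : (Fin n → ℝ) → ℝ) {x : Fin n → ℝ} (hx : x ∈ cube n) :
    xGrad w x ^ 2 ≤ n * gradSq w x := by
  refine (Finset.sum_mul_sq_le_sq_mul_sq _ _ _).trans
    (mul_le_mul_of_nonneg_right ?_ (gradSq_nonneg w x))
  calc ∑ p, x p ^ 2 ≤ ∑ _p : Fin n, (1:ℝ) := Finset.sum_le_sum fun p _ => by
        have := hx p (mem_univ p)
        exact pow_le_one₀ this.1 this.2
    _ = n := by simp

/-- Tangential derivatives vanish on the Dirichlet part of the boundary. -/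
lemma pd_eq_zero_of_ne (hw : ContDiff ℝ 1 w)
    (h0 : ∀ x ∈ cube n, (∃ p, x p = 0) → w x = 0) {x : Fin n → ℝ} (hx : x ∈ cube n)
    {p q : Fin n} (hp : x p = 0) (hq : q ≠ p) : pd q w x = 0 := by
  have h1 := (hasDerivAt_pd_self hw q x).hasDerivWithinAt (s := Icc 0 1)
  have hmem : x q ∈ Icc (0:ℝ) 1 := hx q (mem_univ q)
  have hz : ∀ s ∈ Icc (0:ℝ) 1, w (update x q s) = 0 := fun s hs =>
    h0 _ (update_mem_cube hx q hs) ⟨p, by rw [update_of_ne hq.symm, hp]⟩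
  have h2 : HasDerivWithinAt (fun s => w (update x q s)) 0 (Icc 0 1) (x q) :=
    (hasDerivWithinAt_const (x q) (Icc 0 1) (0:ℝ)).congr hz (hz _ hmem)
  exact (uniqueDiffOn_Icc zero_lt_one _ hmem).eq_deriv _ h1 h2

lemma integral_gradSq (hw : ContDiff ℝ 1 w) :
    ∫ x in cube n, gradSq w x = ∑ p, ∫ x in cube n, pd p w x ^ 2 :=
  integral_finsetSum _ (f := fun p x => pd p w x ^ 2)
    fun p _ => integrableOn_cube ((continuous_pd hw p).pow 2)

/-- Poincaré's inequality on the cube. -/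
lemma integral_sq_le_gradSq (hn : 1 ≤ n) (hw : ContDiff ℝ 1 w)
    (h0 : ∀ x ∈ cube n, (∃ p, x p = 0) → w x = 0) :
    ∫ x in cube n, w x ^ 2 ≤ 4 / (π ^ 2 * n) * ∫ x in cube n, gradSq w x := by
  have hp : ∀ p : Fin n, (π / 2) ^ 2 * ∫ x in cube n, w x ^ 2 ≤ ∫ x in cube n, pd p w x ^ 2 := by
    intro p
    have c1 : Continuous fun x => w x ^ 2 := hw.continuous.pow 2
    have c2 : Continuous fun x => pd p w x ^ 2 := (continuous_pd hw p).pow 2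
    rw [integral_cube_eq_integral_line c1 p, integral_cube_eq_integral_line c2 p,
      ← integral_const_mul]
    refine integral_cube_mono ((continuous_integral_line c1 p).const_mul _)
      (continuous_integral_line c2 p) fun x hx => ?_
    refine integral_sq_le_integral_deriv_sq (f := fun s => w (update x p s))
      ((continuous_pd hw p).comp (continuous_const.update p continuous_id))
      (hasDerivAt_pd hw p x) (h0 _ (update_mem_cube hx p (by simp)) ⟨p, by simp⟩)
  have hs := Finset.sum_le_sum fun p (_ : p ∈ Finset.univ) => hp p
  rw [← integral_gradSq hw] at hs
  simp only [Finset.sum_const, Finset.card_univ, Fintype.card_fin, nsmul_eq_mul] at hs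
  have hn' : (0:ℝ) < n := by exact_mod_cast hn
  rw [div_mul_eq_mul_div, le_div_iff₀ (by positivity)]
  nlinarith

lemma faceInt_sq_le_gradSq (hw : ContDiff ℝ 1 w)
    (h0 : ∀ x ∈ cube n, (∃ p, x p = 0) → w x = 0) :
    faceInt (fun x => w x ^ 2) ≤ ∫ x in cube n, gradSq w x := by
  rw [integral_gradSq hw]
  refine Finset.sum_le_sum fun p _ => ?_
  have c2 : Continuous fun x => pd p w x ^ 2 := (continuous_pd hw p).pow 2
  rw [integral_cube_eq_integral_line c2 p]
  refine integral_cube_mono ((hw.continuous.comp (continuous_id.update p continuous_const)).pow 2)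
    (continuous_integral_line c2 p) fun x hx => ?_
  exact sq_le_integral_deriv_sq (f := fun s => w (update x p s))
      ((continuous_pd hw p).comp (continuous_const.update p continuous_id))
      (hasDerivAt_pd hw p x) (h0 _ (update_mem_cube hx p (by simp)) ⟨p, by simp⟩)

/-- The `p`-th component of the energy flux. -/
def flux (χ m : ℝ) (w v : (Fin n → ℝ) → ℝ) (p : Fin n) (x : Fin n → ℝ) : ℝ :=
  v x * pd p w x - χ * (x p * v x ^ 2)
    - χ * (2 * (xGrad w x * pd p w x) - x p * gradSq w x) - χ * m * (w x * pd p w x)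

/-- The derivative of `flux` in the `p`-th coordinate. -/
def fluxDeriv (χ m : ℝ) (w v : (Fin n → ℝ) → ℝ) (p : Fin n) (x : Fin n → ℝ) : ℝ :=
  (pd p v x * pd p w x + v x * pd p (pd p w) x)
    - χ * (1 * v x ^ 2 + x p * (2 * v x * pd p v x))
    - χ * (2 * ((pd p w x + ∑ q, x q * pd p (pd q w) x) * pd p w x
        + xGrad w x * pd p (pd p w) x)
      - (1 * gradSq w x + x p * ∑ q, 2 * pd q w x * pd p (pd q w) x))
    - χ * m * (pd p w x * pd p w x + w x * pd p (pd p w) x)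

lemma continuous_fluxDeriv (χ m : ℝ) (hw : ContDiff ℝ 2 w) (hv : ContDiff ℝ 1 v) (p : Fin n) :
    Continuous (fluxDeriv χ m w v p) := by
  have hw1 : ContDiff ℝ 1 w := hw.of_le (by norm_num)
  have h1 := hw.continuous
  have h2 := hv.continuous
  have h3 := fun q => continuous_pd hw1 q
  have h4 := fun q => continuous_pd hv q
  have h5 := fun q r => continuous_pd (contDiff_pd hw q) r
  have h6 := continuous_gradSq hw1
  have h7 := continuous_xGrad hw1
  unfold fluxDeriv
  fun_prop

lemma hasDerivAt_xGrad (hw : ContDiff ℝ 2 w) (p : Fin n) (x : Fin n → ℝ) :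
    HasDerivAt (fun s => xGrad w (update x p s))
      (pd p w x + ∑ q, x q * pd p (pd q w) x) (x p) := by
  have hq : ∀ q ∈ Finset.univ, HasDerivAt
      (fun s => update x p s q * pd q w (update x p s))
      ((Pi.single p (1:ℝ) : Fin n → ℝ) q * pd q w x + x q * pd p (pd q w) x) (x p) := by
    intro q _
    have h1 := hasDerivAt_pi.1 (hasDerivAt_update x p (x p)) q
    simpa using h1.fun_mul (hasDerivAt_pd_self (contDiff_pd hw q) p x)
  refine (HasDerivAt.fun_sum hq).congr_deriv ?_
  rw [Finset.sum_add_distrib]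
  simp [Pi.single_apply]

lemma hasDerivAt_gradSq (hw : ContDiff ℝ 2 w) (p : Fin n) (x : Fin n → ℝ) :
    HasDerivAt (fun s => gradSq w (update x p s))
      (∑ q, 2 * pd q w x * pd p (pd q w) x) (x p) := by
  refine HasDerivAt.fun_sum fun q _ => ?_
  simpa using (hasDerivAt_pd_self (contDiff_pd hw q) p x).fun_pow 2

lemma hasDerivAt_flux (χ m : ℝ) (hw : ContDiff ℝ 2 w) (hv : ContDiff ℝ 1 v) (p : Fin n)
    (x : Fin n → ℝ) :
    HasDerivAt (fun s => flux χ m w v p (update x p s)) (fluxDeriv χ m w v p x) (x p) := by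
  have hw1 : ContDiff ℝ 1 w := hw.of_le (by norm_num)
  have dw := hasDerivAt_pd_self hw1 p x
  have dv := hasDerivAt_pd_self hv p x
  have dp := hasDerivAt_pd_self (contDiff_pd hw p) p x
  have dX := hasDerivAt_xGrad hw p x
  have dG := hasDerivAt_gradSq hw p x
  have dx : HasDerivAt (fun s => update x p s p) 1 (x p) := by
    simpa using hasDerivAt_id' (x p)
  have := (((dv.mul dp).sub ((dx.mul (dv.pow 2)).const_mul χ)).sub
    ((((dX.mul dp).const_mul 2).sub (dx.mul dG)).const_mul χ)).sub
    ((dw.mul dp).const_mul (χ * m))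
  refine this.congr_deriv ?_
  simp [fluxDeriv]

lemma sum_fluxDeriv (χ m : ℝ) (hw : ContDiff ℝ 2 w) (x : Fin n → ℝ) :
    ∑ p, fluxDeriv χ m w v p x =
      (∑ p, pd p v x * pd p w x) + v x * lap w x - χ * (n * v x ^ 2 + 2 * v x * xGrad v x)
      - χ * ((2 - n) * gradSq w x + 2 * xGrad w x * lap w x)
      - χ * m * (gradSq w x + w x * lap w x) := by
  have hsymm : ∑ p, (∑ q, x q * pd p (pd q w) x) * pd p w x
      = ∑ p, x p * ∑ q, pd q w x * pd p (pd q w) x := by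
    simp_rw [Finset.sum_mul, Finset.mul_sum]
    rw [Finset.sum_comm]
    refine Finset.sum_congr rfl fun p _ => Finset.sum_congr rfl fun q _ => ?_
    rw [pd_comm hw q p]
    ring
  have e1 : ∀ p, fluxDeriv χ m w v p x = pd p v x * pd p w x + v x * pd p (pd p w) x
      - χ * v x ^ 2 - χ * (2 * v x) * (x p * pd p v x) - χ * 2 * pd p w x ^ 2
      - χ * 2 * ((∑ q, x q * pd p (pd q w) x) * pd p w x)
      - χ * 2 * xGrad w x * pd p (pd p w) x + χ * gradSq w x
      + χ * 2 * (x p * ∑ q, pd q w x * pd p (pd q w) x)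
      - χ * m * pd p w x ^ 2 - χ * m * w x * pd p (pd p w) x := fun p => by
    simp only [fluxDeriv, mul_assoc, ← Finset.mul_sum]
    ring
  simp only [e1, Finset.sum_add_distrib, Finset.sum_sub_distrib]
  simp only [← Finset.mul_sum, hsymm]
  simp only [Finset.sum_const, Finset.card_univ, Fintype.card_fin, nsmul_eq_mul, lap, gradSq, xGrad]
  ring

lemma flux_eq_zero (χ m : ℝ) (hw : ContDiff ℝ 1 w)
    (h0 : ∀ x ∈ cube n, (∃ p, x p = 0) → w x = 0)
    (h0' : ∀ x ∈ cube n, (∃ p, x p = 0) → v x = 0)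
    {x : Fin n → ℝ} (hx : x ∈ cube n) {p : Fin n} (hp : x p = 0) : flux χ m w v p x = 0 := by
  have hX : xGrad w x = 0 := Finset.sum_eq_zero fun q _ => by
    by_cases hq : q = p
    · rw [hq, hp, zero_mul]
    · rw [pd_eq_zero_of_ne hw h0 hx hp hq, mul_zero]
  simp [flux, hX, hp, h0 x hx ⟨p, hp⟩, h0' x hx ⟨p, hp⟩]

lemma le_flux {χ m k : ℝ} (hn : 1 ≤ n) (hχ : 0 < χ) (hΨ1 : -k + (1 + k ^ 2 * n) * χ ≤ 0)
    {x : Fin n → ℝ} (hx : x ∈ cube n) {p : Fin n} (hp : x p = 1) (hN : pd p w x = k * v x) :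
    -(χ * m * k * (w x * v x)) ≤ flux χ m w v p x := by
  have hX := xGrad_sq_le w hx
  have hn' : (0:ℝ) < n := by exact_mod_cast hn
  have h1 : 2 * (xGrad w x * (k * v x)) ≤ gradSq w x + k ^ 2 * n * v x ^ 2 := by
    refine le_of_mul_le_mul_left ?_ hn'
    nlinarith [sq_nonneg (n * (k * v x) - xGrad w x)]
  rw [flux, hp, hN]
  nlinarith [mul_le_mul_of_nonneg_left h1 hχ.le, mul_nonneg (sub_nonneg.2 hΨ1) (sq_nonneg (v x))]

/-- The flux of the energy through the boundary, bounded below under the impedance condition. -/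
lemma le_integral_sum_fluxDeriv {χ m k : ℝ} (hn : 1 ≤ n) (hχ : 0 < χ)
    (hΨ1 : -k + (1 + k ^ 2 * n) * χ ≤ 0) (hw : ContDiff ℝ 2 w) (hv : ContDiff ℝ 1 v)
    (h0 : ∀ x ∈ cube n, (∃ p, x p = 0) → w x = 0)
    (h0' : ∀ x ∈ cube n, (∃ p, x p = 0) → v x = 0)
    (hN : ∀ x ∈ cube n, ∀ p, x p = 1 → pd p w x = k * v x) :
    -(χ * m * k) * faceInt (fun x => w x * v x)
      ≤ ∫ x in cube n, ∑ p, fluxDeriv χ m w v p x := by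
  have hw1 : ContDiff ℝ 1 w := hw.of_le (by norm_num)
  rw [integral_finsetSum _ fun p _ => integrableOn_cube (continuous_fluxDeriv χ m hw hv p),
    faceInt, Finset.mul_sum]
  refine Finset.sum_le_sum fun p _ => ?_
  rw [integral_cube_lineDeriv p (continuous_fluxDeriv χ m hw hv p)
    (hasDerivAt_flux χ m hw hv p), ← integral_const_mul]
  have hup : ∀ s : ℝ, Continuous fun x : Fin n → ℝ => update x p s := fun s =>
    continuous_id.update p continuous_const
  have hfl : Continuous (flux χ m w v p) := by
    have h1 := hw.continuous
    have h2 := hv.continuous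
    have h3 := continuous_pd hw1 p
    have h6 := continuous_gradSq hw1
    have h7 := continuous_xGrad hw1
    unfold flux
    fun_prop
  refine integral_cube_mono
    (((hw.continuous.mul hv.continuous).comp (hup 1)).const_mul _)
    ((hfl.comp (hup 1)).sub (hfl.comp (hup 0))) fun x hx => ?_
  have hx1 := update_mem_cube hx p (s := 1) (by simp)
  have hx0 := update_mem_cube hx p (s := 0) (by simp)
  rw [flux_eq_zero χ m hw1 h0 h0' hx0 (by simp), sub_zero, neg_mul]
  exact le_flux hn hχ hΨ1 hx1 (by simp) (hN _ hx1 p (by simp))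

end PartialDerivatives

section Rayleigh

lemma rayleigh_set_eq (M : Matrix (Fin 3) (Fin 3) ℝ) :
    {r | ∃ v : Fin 3 → ℝ, (∑ i, (v i) ^ 2) = 1 ∧ r = v ⬝ᵥ M.mulVec v}
      = (fun v : Fin 3 → ℝ => v ⬝ᵥ M.mulVec v) '' {v | ∑ i, v i ^ 2 = 1} := by
  ext r
  simp [eq_comm]

lemma isCompact_unitSphere_fin_three : IsCompact {v : Fin 3 → ℝ | ∑ i, v i ^ 2 = 1} := by
  refine (isCompact_univ_pi fun _ : Fin 3 => isCompact_Icc (a := (-1:ℝ)) (b := 1)).of_isClosed_subset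
    (isClosed_eq (by fun_prop) continuous_const) fun v hv i _ => ?_
  have : v i ^ 2 ≤ 1 := hv ▸ Finset.single_le_sum (f := fun i => v i ^ 2)
    (fun i _ => sq_nonneg _) (Finset.mem_univ i)
  exact abs_le.1 (abs_le_one_iff_mul_self_le_one.2 (by nlinarith))

lemma isCompact_rayleigh (M : Matrix (Fin 3) (Fin 3) ℝ) :
    IsCompact {r | ∃ v : Fin 3 → ℝ, (∑ i, (v i) ^ 2) = 1 ∧ r = v ⬝ᵥ M.mulVec v} := by
  rw [rayleigh_set_eq]
  exact isCompact_unitSphere_fin_three.image (by fun_prop)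

lemma exists_unit_smul {v : Fin 3 → ℝ} (hv : v ≠ 0) :
    ∃ (c : ℝ) (u : Fin 3 → ℝ), c ^ 2 = ∑ i, v i ^ 2 ∧ ∑ i, u i ^ 2 = 1 ∧ v = c • u := by
  have hpos : 0 < ∑ i, v i ^ 2 := by
    obtain ⟨i, hi⟩ := Function.ne_iff.1 hv
    exact Finset.sum_pos' (fun i _ => sq_nonneg _) ⟨i, Finset.mem_univ i, by
      have : v i ≠ 0 := hi
      positivity⟩
  have hc := Real.sq_sqrt hpos.le
  have hc0 := (Real.sqrt_pos.2 hpos).ne'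
  refine ⟨√(∑ i, v i ^ 2), (√(∑ i, v i ^ 2))⁻¹ • v, hc, ?_, ?_⟩
  · simp only [Pi.smul_apply, smul_eq_mul, mul_pow, ← Finset.mul_sum]
    rw [inv_pow, hc, inv_mul_cancel₀ hpos.ne']
  · rw [smul_smul, mul_inv_cancel₀ hc0, one_smul]

lemma smul_quadForm (M : Matrix (Fin 3) (Fin 3) ℝ) (c : ℝ) (u : Fin 3 → ℝ) :
    (c • u) ⬝ᵥ M.mulVec (c • u) = c ^ 2 * (u ⬝ᵥ M.mulVec u) := by
  rw [Matrix.mulVec_smul, smul_dotProduct, dotProduct_smul, smul_eq_mul, smul_eq_mul]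
  ring

lemma lamMin_mul_le (M : Matrix (Fin 3) (Fin 3) ℝ) (v : Fin 3 → ℝ) :
    lamMin M * ∑ i, v i ^ 2 ≤ v ⬝ᵥ M.mulVec v := by
  rcases eq_or_ne v 0 with rfl | hv
  · simp
  obtain ⟨c, u, hc, hu, rfl⟩ := exists_unit_smul hv
  rw [← hc, smul_quadForm, mul_comm]
  exact mul_le_mul_of_nonneg_left (csInf_le (isCompact_rayleigh M).bddBelow ⟨u, hu, rfl⟩)
    (sq_nonneg c)

lemma le_lamMax_mul (M : Matrix (Fin 3) (Fin 3) ℝ) (v : Fin 3 → ℝ) :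
    v ⬝ᵥ M.mulVec v ≤ lamMax M * ∑ i, v i ^ 2 := by
  rcases eq_or_ne v 0 with rfl | hv
  · simp
  obtain ⟨c, u, hc, hu, rfl⟩ := exists_unit_smul hv
  rw [← hc, smul_quadForm, mul_comm (lamMax M)]
  exact mul_le_mul_of_nonneg_left (le_csSup (isCompact_rayleigh M).bddAbove ⟨u, hu, rfl⟩)
    (sq_nonneg c)

lemma lamMin_pos {M : Matrix (Fin 3) (Fin 3) ℝ} (hM : M.PosDef) : 0 < lamMin M := by
  obtain ⟨v, hv, h⟩ := (isCompact_rayleigh M).sInf_mem ⟨_, ![1, 0, 0], by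
    simp [Fin.sum_univ_three], rfl⟩
  rw [lamMin, h]
  have hv0 : v ≠ 0 := by
    rintro rfl
    simp at hv
  simpa using hM.dotProduct_mulVec_pos hv0

end Rayleigh

section Pointwise

variable {n : ℕ} {χ lam0 : ℝ}

lemma quadForm_Phi0 (a b c : ℝ) :
    ![a, b, c] ⬝ᵥ (Phi0 n χ lam0).mulVec ![a, b, c] =
      (1 / 2 - 4 * lam0 / (π ^ 2 * n)) * a ^ 2 + 1 / 2 * b ^ 2 + lam0 * c ^ 2
        + 2 * √n * χ * (a * b) + (n - 1) * χ * (b * c) := by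
  simp [Phi0, Matrix.mulVec, dotProduct, Fin.sum_univ_three]
  ring

lemma quadForm_Phi1 (a b c : ℝ) :
    ![a, b, c] ⬝ᵥ (Phi1 n χ lam0).mulVec ![a, b, c] =
      1 / 2 * a ^ 2 + 1 / 2 * b ^ 2 + lam0 * c ^ 2
        + 2 * √n * χ * (a * b) + (n - 1) * χ * (b * c) := by
  rw [Phi1, Matrix.add_mulVec, dotProduct_add, quadForm_Phi0]
  simp [Matrix.mulVec_diagonal, dotProduct, Fin.sum_univ_three]
  ring

lemma quadForm_Psi2 (k δ g1 lam1 a b c : ℝ) :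
    ![a, b, c] ⬝ᵥ (Psi2 n k χ δ g1 lam1).mulVec ![a, b, c] =
      (-χ + δ * (1 + χ * k * (n - 1)) + 4 * lam1 / (π ^ 2 * n)) * a ^ 2 + (-χ + δ) * b ^ 2
        + (-lam1 + g1 * (n - 1) * χ) * c ^ 2 + 4 * δ * √n * χ * (a * b)
        + 2 * √n * g1 * χ * (a * c) + (g1 + 2 * δ * (n - 1) * χ) * (b * c) := by
  simp [Psi2, Matrix.mulVec, dotProduct, Fin.sum_univ_three]
  ring

lemma lamMax_Phi1_nonneg : 0 ≤ lamMax (Phi1 n χ lam0) := by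
  have := le_lamMax_mul (Phi1 n χ lam0) ![0, 1, 0]
  rw [quadForm_Phi1] at this
  simp [Fin.sum_univ_three] at this
  linarith

lemma abs_xGrad_le (w : (Fin n → ℝ) → ℝ) {x : Fin n → ℝ} (hx : x ∈ cube n) :
    |xGrad w x| ≤ √n * √(gradSq w x) := by
  rw [← Real.sqrt_mul (Nat.cast_nonneg n)]
  exact Real.abs_le_sqrt (xGrad_sq_le w hx)

/-- The density of the backward Lyapunov function. -/
def lyapDensity (χ : ℝ) (w v : (Fin n → ℝ) → ℝ) (x : Fin n → ℝ) : ℝ :=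
  (gradSq w x + v x ^ 2) / 2 - χ * ((2 * xGrad w x + (n - 1) * w x) * v x)

lemma abs_cross_le (hn : 1 ≤ n) (w : (Fin n → ℝ) → ℝ) {x : Fin n → ℝ} (hx : x ∈ cube n) (r : ℝ) :
    |(2 * xGrad w x + (n - 1) * w x) * r|
      ≤ 2 * √n * (√(gradSq w x) * |r|) + (n - 1) * (|r| * |w x|) := by
  have hn' : (1:ℝ) ≤ n := by exact_mod_cast hn
  have h : |2 * xGrad w x + (n - 1) * w x| ≤ 2 * (√n * √(gradSq w x)) + (n - 1) * |w x| := by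
    refine (abs_add_le _ _).trans (add_le_add ?_ ?_)
    · rw [abs_mul, abs_two]
      exact mul_le_mul_of_nonneg_left (abs_xGrad_le w hx) zero_le_two
    · rw [abs_mul, abs_of_nonneg (sub_nonneg.2 hn')]
  rw [abs_mul]
  exact (mul_le_mul_of_nonneg_right h (abs_nonneg r)).trans_eq (by ring)

lemma le_lyapDensity (hn : 1 ≤ n) (hχ : 0 < χ) (hΦ0 : (Phi0 n χ lam0).PosDef)
    (w v : (Fin n → ℝ) → ℝ) {x : Fin n → ℝ} (hx : x ∈ cube n) :
    lamMin (Phi0 n χ lam0) * (gradSq w x + v x ^ 2) + 4 * lam0 / (π ^ 2 * n) * gradSq w x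
      ≤ lyapDensity χ w v x + lam0 * w x ^ 2 := by
  have h1 := lamMin_mul_le (Phi0 n χ lam0) ![√(gradSq w x), -|v x|, |w x|]
  have h2 := mul_nonneg (lamMin_pos hΦ0).le (sq_nonneg (w x))
  have h3 := mul_le_mul_of_nonneg_left ((le_abs_self _).trans (abs_cross_le hn w hx (v x))) hχ.le
  rw [quadForm_Phi0] at h1
  simp [Fin.sum_univ_three, Real.sq_sqrt (gradSq_nonneg w x)] at h1
  rw [lyapDensity]
  linarith

lemma lyapDensity_le (hn : 1 ≤ n) (hχ : 0 < χ) (hl0 : 0 < lam0)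
    (w v : (Fin n → ℝ) → ℝ) {x : Fin n → ℝ} (hx : x ∈ cube n) :
    lyapDensity χ w v x ≤ lamMax (Phi1 n χ lam0) * (gradSq w x + v x ^ 2 + w x ^ 2) := by
  have h1 := le_lamMax_mul (Phi1 n χ lam0) ![√(gradSq w x), |v x|, |w x|]
  have h2 := mul_nonneg hl0.le (sq_nonneg (w x))
  have h3 := mul_le_mul_of_nonneg_left ((neg_le_abs _).trans (abs_cross_le hn w hx (v x))) hχ.le
  rw [quadForm_Phi1] at h1
  simp [Fin.sum_univ_three, Real.sq_sqrt (gradSq_nonneg w x)] at h1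
  rw [lyapDensity]
  linarith

/-- Pointwise dissipation estimate. -/
lemma le_dissipation {k δ g1 lam1 : ℝ} (hn : 1 ≤ n) (hχ : 0 < χ) (hδ : 0 < δ)
    (hΨ2 : NegSemidefM (Psi2 n k χ δ g1 lam1)) (w v : (Fin n → ℝ) → ℝ)
    {x : Fin n → ℝ} (hx : x ∈ cube n) {r : ℝ} (hr : |r| ≤ g1) :
    4 * lam1 / (π ^ 2 * n) * gradSq w x ≤
      v x * (r * w x) + χ * (v x ^ 2 + gradSq w x)
        - χ * ((2 * xGrad w x + (n - 1) * w x) * (r * w x))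
        - 2 * δ * lyapDensity χ w v x - δ * (χ * k * (n - 1)) * gradSq w x + lam1 * w x ^ 2 := by
  have hn' : (1:ℝ) ≤ n := by exact_mod_cast hn
  have h1 := hΨ2.dotProduct_mulVec_nonneg ![√(gradSq w x), |v x|, |w x|]
  rw [star_trivial, Matrix.neg_mulVec, dotProduct_neg, quadForm_Psi2] at h1
  have hrw : |r * w x| ≤ g1 * |w x| := by
    rw [abs_mul]
    exact mul_le_mul_of_nonneg_right hr (abs_nonneg _)
  have h2 := mul_le_mul_of_nonneg_left
    ((neg_le_abs _).trans (abs_cross_le hn w hx (v x))) (mul_pos hδ hχ).le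
  have h3 : (2 * xGrad w x + (n - 1) * w x) * (r * w x)
      ≤ 2 * √n * (√(gradSq w x) * (g1 * |w x|)) + (n - 1) * ((g1 * |w x|) * |w x|) := by
    refine ((le_abs_self _).trans (abs_cross_le hn w hx _)).trans ?_
    have := sub_nonneg.2 hn'
    gcongr
  have h4 : -(|v x| * (g1 * |w x|)) ≤ v x * (r * w x) := by
    refine (neg_le_neg ?_).trans (neg_abs_le _)
    rw [abs_mul (v x)]
    exact mul_le_mul_of_nonneg_left hrw (abs_nonneg _)
  have h5 := mul_le_mul_of_nonneg_left h3 hχ.le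
  have e1 : |w x| * |w x| = w x ^ 2 := by rw [← sq, sq_abs]
  rw [mul_assoc g1, e1] at h5
  simp only [Real.sq_sqrt (gradSq_nonneg w x), sq_abs] at h1
  rw [lyapDensity]
  linarith

end Pointwise

section TimeDependence

variable {n : ℕ} {u : ℝ → (Fin n → ℝ) → ℝ}

/-- The time derivative `∂ₜu`. -/
def td (u : ℝ → (Fin n → ℝ) → ℝ) (t : ℝ) (x : Fin n → ℝ) : ℝ := deriv (fun s => u s x) t

lemma contDiff_slice {m : WithTop ℕ∞} (hu : ContDiff ℝ m fun q : ℝ × (Fin n → ℝ) => u q.1 q.2)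
    (t : ℝ) : ContDiff ℝ m (u t) :=
  hu.comp (contDiff_const.prodMk contDiff_id)

lemma hasDerivAt_time (hu : ContDiff ℝ 1 fun q : ℝ × (Fin n → ℝ) => u q.1 q.2) (t : ℝ)
    (x : Fin n → ℝ) : HasDerivAt (fun s => u s x)
      (fderiv ℝ (fun q : ℝ × (Fin n → ℝ) => u q.1 q.2) (t, x) (1, 0)) t := by
  have h : HasFDerivAt (fun q : ℝ × (Fin n → ℝ) => u q.1 q.2)
    (fderiv ℝ (fun q : ℝ × (Fin n → ℝ) => u q.1 q.2) (t, x)) (t, x) :=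
    (hu.differentiable one_ne_zero (t, x)).hasFDerivAt
  exact h.comp_hasDerivAt t ((hasDerivAt_id t).prodMk (hasDerivAt_const t x))

lemma hasDerivAt_td (hu : ContDiff ℝ 1 fun q : ℝ × (Fin n → ℝ) => u q.1 q.2) (t : ℝ)
    (x : Fin n → ℝ) : HasDerivAt (fun s => u s x) (td u t x) t :=
  (hasDerivAt_time hu t x).differentiableAt.hasDerivAt

lemma td_eq_fderiv (hu : ContDiff ℝ 1 fun q : ℝ × (Fin n → ℝ) => u q.1 q.2) (t : ℝ)
    (x : Fin n → ℝ) :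
    td u t x = fderiv ℝ (fun q : ℝ × (Fin n → ℝ) => u q.1 q.2) (t, x) (1, 0) :=
  (hasDerivAt_time hu t x).deriv

lemma pd_eq_fderiv (hu : ContDiff ℝ 1 fun q : ℝ × (Fin n → ℝ) => u q.1 q.2) (p : Fin n) (t : ℝ)
    (x : Fin n → ℝ) :
    pd p (u t) x
      = fderiv ℝ (fun q : ℝ × (Fin n → ℝ) => u q.1 q.2) (t, x) (0, Pi.single p 1) := by
  have h := ((hu.differentiable one_ne_zero (t, x)).hasFDerivAt).comp x
    ((hasFDerivAt_const t x).prodMk (hasFDerivAt_id x))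
  have h' : HasFDerivAt (u t) _ x := h
  rw [pd, h'.fderiv]
  simp

lemma continuous_td (hu : ContDiff ℝ 1 fun q : ℝ × (Fin n → ℝ) => u q.1 q.2) :
    Continuous fun q : ℝ × (Fin n → ℝ) => td u q.1 q.2 := by
  simp_rw [td_eq_fderiv hu]
  exact (hu.continuous_fderiv one_ne_zero).clm_apply continuous_const

lemma continuous_pd_slice (hu : ContDiff ℝ 1 fun q : ℝ × (Fin n → ℝ) => u q.1 q.2) (p : Fin n) :
    Continuous fun q : ℝ × (Fin n → ℝ) => pd p (u q.1) q.2 := by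
  simp_rw [pd_eq_fderiv hu]
  exact (hu.continuous_fderiv one_ne_zero).clm_apply continuous_const

lemma contDiff_td (hu : ContDiff ℝ 2 fun q : ℝ × (Fin n → ℝ) => u q.1 q.2) :
    ContDiff ℝ 1 fun q : ℝ × (Fin n → ℝ) => td u q.1 q.2 := by
  simp_rw [td_eq_fderiv (hu.of_le (by norm_num))]
  exact (hu.fderiv_right (m := 1) (by norm_num)).clm_apply contDiff_const

lemma contDiff_pd_slice (hu : ContDiff ℝ 2 fun q : ℝ × (Fin n → ℝ) => u q.1 q.2) (p : Fin n) :
    ContDiff ℝ 1 fun q : ℝ × (Fin n → ℝ) => pd p (u q.1) q.2 := by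
  simp_rw [pd_eq_fderiv (hu.of_le (by norm_num))]
  exact (hu.fderiv_right (m := 1) (by norm_num)).clm_apply contDiff_const

lemma hasDerivAt_pd_time (hu : ContDiff ℝ 2 fun q : ℝ × (Fin n → ℝ) => u q.1 q.2) (p : Fin n)
    (t : ℝ) (x : Fin n → ℝ) : HasDerivAt (fun s => pd p (u s) x) (pd p (td u t) x) t := by
  have hu1 : ContDiff ℝ 1 fun q : ℝ × (Fin n → ℝ) => u q.1 q.2 := hu.of_le (by norm_num)
  refine (hasDerivAt_time (u := fun s => pd p (u s)) (contDiff_pd_slice hu p) t x).congr_deriv ?_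
  rw [pd_eq_fderiv (contDiff_td hu)]
  simp_rw [pd_eq_fderiv hu1, td_eq_fderiv hu1]
  have h2 : DifferentiableAt ℝ (fderiv ℝ fun q : ℝ × (Fin n → ℝ) => u q.1 q.2) (t, x) :=
    (hu.fderiv_right (m := 1) (by norm_num)).differentiable one_ne_zero _
  simp only [Prod.mk.eta]
  rw [fderiv_clm_apply h2 (differentiableAt_const _),
    fderiv_clm_apply h2 (differentiableAt_const _)]
  simpa using (hu.contDiffAt.isSymmSndFDerivAt (by simp)).eq _ _

/-- The time derivative of the density of the Lyapunov function. -/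
def lyapDensityDeriv (χ : ℝ) (w v a : (Fin n → ℝ) → ℝ) (x : Fin n → ℝ) : ℝ :=
  (∑ p, pd p v x * pd p w x) + v x * a x
    - χ * ((2 * xGrad v x + (n - 1) * v x) * v x + (2 * xGrad w x + (n - 1) * w x) * a x)

lemma hasDerivAt_lyapDensity (χ : ℝ)
    (hu : ContDiff ℝ 2 fun q : ℝ × (Fin n → ℝ) => u q.1 q.2) (t : ℝ) (x : Fin n → ℝ) :
    HasDerivAt (fun s => lyapDensity χ (u s) (td u s) x)
      (lyapDensityDeriv χ (u t) (td u t) (td (td u) t) x) t := by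
  have hu1 : ContDiff ℝ 1 fun q : ℝ × (Fin n → ℝ) => u q.1 q.2 := hu.of_le (by norm_num)
  have dw := hasDerivAt_td hu1 t x
  have dv := hasDerivAt_td (contDiff_td hu) t x
  have dX : HasDerivAt (fun s => xGrad (u s) x) (xGrad (td u t) x) t :=
    HasDerivAt.fun_sum fun p _ => (hasDerivAt_pd_time hu p t x).const_mul (x p)
  have dG : HasDerivAt (fun s => gradSq (u s) x)
      (∑ p, 2 * (pd p (td u t) x * pd p (u t) x)) t := by
    refine HasDerivAt.fun_sum fun p _ => ?_
    refine ((hasDerivAt_pd_time hu p t x).fun_pow 2).congr_deriv ?_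
    simp
    ring
  have := ((dG.add (dv.pow 2)).div_const 2).sub
    ((((dX.const_mul 2).add (dw.const_mul ((n:ℝ) - 1))).mul dv).const_mul χ)
  refine this.congr_deriv ?_
  rw [← Finset.mul_sum]
  simp [lyapDensityDeriv]
  ring

lemma continuous_lyapDensityDeriv (χ : ℝ)
    (hu : ContDiff ℝ 2 fun q : ℝ × (Fin n → ℝ) => u q.1 q.2) :
    Continuous fun q : ℝ × (Fin n → ℝ) =>
      lyapDensityDeriv χ (u q.1) (td u q.1) (td (td u) q.1) q.2 := by
  have hu1 : ContDiff ℝ 1 fun q : ℝ × (Fin n → ℝ) => u q.1 q.2 := hu.of_le (by norm_num)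
  have h1 := hu.continuous
  have h2 := continuous_td hu1
  have h3 := continuous_td (contDiff_td hu)
  have h4 := continuous_pd_slice hu1
  have h5 := continuous_pd_slice (contDiff_td hu)
  unfold lyapDensityDeriv xGrad
  fun_prop

lemma continuous_lyapDensity (χ : ℝ) {w v : (Fin n → ℝ) → ℝ} (hw : ContDiff ℝ 1 w)
    (hv : Continuous v) : Continuous (lyapDensity χ w v) := by
  have h1 := hw.continuous
  have h6 := continuous_gradSq hw
  have h7 := continuous_xGrad hw
  unfold lyapDensity
  fun_prop

/-- The backward Lyapunov function. -/
def lyap (χ k : ℝ) (u : ℝ → (Fin n → ℝ) → ℝ) (t : ℝ) : ℝ :=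
  (∫ x in cube n, lyapDensity χ (u t) (td u t) x)
    + χ * k * (n - 1) / 2 * faceInt fun x => u t x ^ 2

lemma hasDerivAt_lyap (χ k : ℝ) (hu : ContDiff ℝ 2 fun q : ℝ × (Fin n → ℝ) => u q.1 q.2) (t : ℝ) :
    HasDerivAt (lyap χ k u)
      ((∫ x in cube n, lyapDensityDeriv χ (u t) (td u t) (td (td u) t) x)
        + χ * k * (n - 1) * faceInt fun x => u t x * td u t x) t := by
  have hu1 : ContDiff ℝ 1 fun q : ℝ × (Fin n → ℝ) => u q.1 q.2 := hu.of_le (by norm_num)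
  have h1 := hasDerivAt_integral_cube
    (F := fun t => lyapDensity χ (u t) (td u t))
    (F' := fun t => lyapDensityDeriv χ (u t) (td u t) (td (td u) t))
    (fun s => continuous_lyapDensity χ (contDiff_slice hu1 s)
      (contDiff_slice (contDiff_td hu) s).continuous)
    (continuous_lyapDensityDeriv χ hu) (hasDerivAt_lyapDensity χ hu) t
  have h2 : HasDerivAt (fun s => faceInt fun x => u s x ^ 2)
      (∑ p, ∫ x in cube n, 2 * (u t (update x p 1) * td u t (update x p 1))) t := by
    refine HasDerivAt.fun_sum fun p _ => ?_
    have c1 := hu.continuous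
    have c2 := continuous_td hu1
    have hup : Continuous fun q : ℝ × (Fin n → ℝ) => (q.1, update q.2 p 1) :=
      continuous_fst.prodMk (continuous_snd.update p continuous_const)
    refine hasDerivAt_integral_cube (F := fun s x => u s (update x p 1) ^ 2)
      (F' := fun t x => 2 * (u t (update x p 1) * td u t (update x p 1)))
      (fun s => ((contDiff_slice hu s).continuous.comp
        (continuous_id.update p continuous_const)).pow 2)
      (((c1.comp hup).mul (c2.comp hup)).const_mul 2) (fun s x => ?_) t
    refine ((hasDerivAt_td hu1 s (update x p 1)).fun_pow 2).congr_deriv ?_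
    simp
    ring
  refine (h1.add (h2.const_mul (χ * k * (n - 1) / 2))).congr_deriv ?_
  simp_rw [integral_const_mul, ← Finset.mul_sum]
  rw [faceInt]
  ring

end TimeDependence

section Lyapunov

variable {n : ℕ} {u : ℝ → (Fin n → ℝ) → ℝ} {k δ g1 χ lam0 lam1 : ℝ}

/-- The energy `∫ (|∇u|² + uₜ²)`. -/
def energy (u : ℝ → (Fin n → ℝ) → ℝ) (t : ℝ) : ℝ :=
  ∫ x in cube n, (gradSq (u t) x + td u t x ^ 2)

lemma alphaC_mul_energy_le (hn : 1 ≤ n) (hk : 0 < k) (hχ : 0 < χ) (hl0 : 0 < lam0)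
    (hΦ0 : (Phi0 n χ lam0).PosDef) (hu : ContDiff ℝ 2 fun q : ℝ × (Fin n → ℝ) => u q.1 q.2)
    {t : ℝ} (h0 : ∀ x ∈ cube n, (∃ p, x p = 0) → u t x = 0) :
    alphaC n χ lam0 * energy u t ≤ 2 * lyap χ k u t := by
  have hw : ContDiff ℝ 1 (u t) := contDiff_slice (hu.of_le (by norm_num)) t
  have hv : Continuous (td u t) := (contDiff_slice (contDiff_td hu) t).continuous
  have hn' : (1:ℝ) ≤ n := by exact_mod_cast hn
  have cG := continuous_gradSq hw
  have cL := continuous_lyapDensity χ hw hv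
  have cw := hw.continuous
  have h := integral_cube_mono (by fun_prop) (by fun_prop) fun x hx =>
    le_lyapDensity hn hχ hΦ0 (u t) (td u t) hx
  rw [integral_add (integrableOn_cube (by fun_prop)) (integrableOn_cube (by fun_prop)),
    integral_add (integrableOn_cube (by fun_prop)) (integrableOn_cube (by fun_prop)),
    integral_const_mul, integral_const_mul, integral_const_mul] at h
  have hP := mul_le_mul_of_nonneg_left (integral_sq_le_gradSq hn hw h0) hl0.le
  have hF : 0 ≤ faceInt fun x => u t x ^ 2 :=
    Finset.sum_nonneg fun p _ => integral_nonneg fun x => sq_nonneg _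
  have hF' : 0 ≤ χ * k * (n - 1) / 2 * faceInt fun x => u t x ^ 2 := by
    have := sub_nonneg.2 hn'
    positivity
  have e1 : lam0 * (4 / (π ^ 2 * n) * ∫ x in cube n, gradSq (u t) x)
      = 4 * lam0 / (π ^ 2 * n) * ∫ x in cube n, gradSq (u t) x := by ring
  rw [alphaC, lyap, energy]
  linarith

lemma two_mul_lyap_le (hn : 1 ≤ n) (hk : 0 < k) (hχ : 0 < χ) (hl0 : 0 < lam0)
    (hu : ContDiff ℝ 2 fun q : ℝ × (Fin n → ℝ) => u q.1 q.2)
    {t : ℝ} (h0 : ∀ x ∈ cube n, (∃ p, x p = 0) → u t x = 0) :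
    2 * lyap χ k u t ≤ betaC n k χ lam0 * energy u t := by
  have hw : ContDiff ℝ 1 (u t) := contDiff_slice (hu.of_le (by norm_num)) t
  have hv : Continuous (td u t) := (contDiff_slice (contDiff_td hu) t).continuous
  have hn' : (1:ℝ) ≤ n := by exact_mod_cast hn
  have cG := continuous_gradSq hw
  have cL := continuous_lyapDensity χ hw hv
  have cw := hw.continuous
  have h := integral_cube_mono (by fun_prop) (by fun_prop) fun x hx =>
    lyapDensity_le hn hχ hl0 (u t) (td u t) hx
  rw [integral_const_mul,
    integral_add (integrableOn_cube (by fun_prop)) (integrableOn_cube (by fun_prop))] at h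
  have hGE : ∫ x in cube n, gradSq (u t) x ≤ energy u t :=
    integral_cube_mono (by fun_prop) (by fun_prop) fun x _ =>
      le_add_of_nonneg_right (sq_nonneg (td u t x))
  have hP := (integral_sq_le_gradSq hn hw h0).trans
    (mul_le_mul_of_nonneg_left hGE (by positivity))
  have hF := (faceInt_sq_le_gradSq hw h0).trans hGE
  have h2 := mul_le_mul_of_nonneg_left hP (lamMax_Phi1_nonneg (n := n) (χ := χ) (lam0 := lam0))
  have h3 := mul_le_mul_of_nonneg_left hF
    (mul_nonneg (mul_pos hχ hk).le (sub_nonneg.2 hn'))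
  rw [mul_add] at h
  change _ ≤ _ * energy u t + _ at h
  rw [betaC, lyap]
  linarith

/-- The differential inequality `V' ≥ 2δV` for the backward Lyapunov function. -/
lemma two_mul_lyap_le_deriv (hn : 1 ≤ n) (hk : 0 < k) (hδ : 0 < δ) (hχ : 0 < χ) (hl1 : 0 < lam1)
    (hΨ1 : -k + (1 + k ^ 2 * n) * χ ≤ 0) (hΨ2 : NegSemidefM (Psi2 n k χ δ g1 lam1))
    (hu : ContDiff ℝ 2 fun q : ℝ × (Fin n → ℝ) => u q.1 q.2) {t : ℝ} {r : (Fin n → ℝ) → ℝ}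
    (hr : Continuous r) (hrb : ∀ x ∈ cube n, |r x| ≤ g1)
    (hwave : ∀ x ∈ cube n, td (td u) t x = lap (u t) x + r x * u t x)
    (h0 : ∀ x ∈ cube n, (∃ p, x p = 0) → u t x = 0)
    (h0' : ∀ x ∈ cube n, (∃ p, x p = 0) → td u t x = 0)
    (hN : ∀ x ∈ cube n, ∀ p, x p = 1 → pd p (u t) x = k * td u t x) :
    2 * δ * lyap χ k u t ≤ deriv (lyap χ k u) t := by
  have hw2 : ContDiff ℝ 2 (u t) := contDiff_slice hu t
  have hw : ContDiff ℝ 1 (u t) := hw2.of_le (by norm_num)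
  have hv1 : ContDiff ℝ 1 (td u t) := contDiff_slice (contDiff_td hu) t
  have hv := hv1.continuous
  have hn' : (1:ℝ) ≤ n := by exact_mod_cast hn
  have cG := continuous_gradSq hw
  have cX := continuous_xGrad hw
  have cL := continuous_lyapDensity χ hw hv
  have cw := hw.continuous
  have cF := continuous_fluxDeriv χ (n - 1) hw2 hv1
  rw [(hasDerivAt_lyap χ k hu t).deriv]
  set R : (Fin n → ℝ) → ℝ := fun x => td u t x * (r x * u t x)
      + χ * (td u t x ^ 2 + gradSq (u t) x)
      - χ * ((2 * xGrad (u t) x + (n - 1) * u t x) * (r x * u t x)) with hR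
  have cR : Continuous R := by fun_prop
  have hsplit : ∫ x in cube n, lyapDensityDeriv χ (u t) (td u t) (td (td u) t) x
      = (∫ x in cube n, ∑ p, fluxDeriv χ (n - 1) (u t) (td u t) p x)
        + ∫ x in cube n, R x := by
    rw [← integral_add (integrableOn_cube (by fun_prop)) (integrableOn_cube cR)]
    refine setIntegral_congr_fun isCompact_cube.measurableSet fun x hx => ?_
    simp only [hR]
    rw [lyapDensityDeriv, hwave x hx, sum_fluxDeriv χ _ hw2]
    ring
  have hflux := le_integral_sum_fluxDeriv (m := (n:ℝ) - 1) hn hχ hΨ1 hw2 hv1 h0 h0' hN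
  have hdis := integral_cube_mono (by fun_prop) (by fun_prop) fun x hx =>
    le_dissipation hn hχ hδ hΨ2 (u t) (td u t) hx (hrb x hx)
  change _ ≤ ∫ x in cube n, (R x - 2 * δ * lyapDensity χ (u t) (td u t) x
    - δ * (χ * k * (n - 1)) * gradSq (u t) x + lam1 * u t x ^ 2) at hdis
  rw [integral_add (integrableOn_cube (by fun_prop)) (integrableOn_cube (by fun_prop)),
    integral_sub (integrableOn_cube (by fun_prop)) (integrableOn_cube (by fun_prop)),
    integral_sub (integrableOn_cube (by fun_prop)) (integrableOn_cube (by fun_prop)),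
    integral_const_mul, integral_const_mul, integral_const_mul, integral_const_mul] at hdis
  have hP := mul_le_mul_of_nonneg_left (integral_sq_le_gradSq hn hw h0) hl1.le
  have hF := mul_le_mul_of_nonneg_left (faceInt_sq_le_gradSq hw h0)
    (mul_nonneg hδ.le (mul_nonneg (mul_pos hχ hk).le (sub_nonneg.2 hn')))
  have e1 : lam1 * (4 / (π ^ 2 * n) * ∫ x in cube n, gradSq (u t) x)
      = 4 * lam1 / (π ^ 2 * n) * ∫ x in cube n, gradSq (u t) x := by ring
  rw [hsplit, lyap]
  linarith

lemma exp_mul_le_of_deriv {V : ℝ → ℝ} (hV : Differentiable ℝ V) {t0 t1 c : ℝ}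
    (h : ∀ t ∈ Ioo t0 t1, c * V t ≤ deriv V t) {t : ℝ} (ht : t ∈ Icc t0 t1) :
    V t0 ≤ exp (-c * (t - t0)) * V t := by
  have hd : ∀ s, HasDerivAt (fun s => exp (-c * (s - t0)) * V s)
      (exp (-c * (s - t0)) * (deriv V s - c * V s)) s := fun s => by
    have h1 : HasDerivAt (fun s : ℝ => -c * (s - t0)) (-c) s := by
      simpa using ((hasDerivAt_id' s).sub_const t0).const_mul (-c)
    refine (h1.exp.fun_mul (hV s).hasDerivAt).congr_deriv ?_
    ring
  have hmono : MonotoneOn (fun s => exp (-c * (s - t0)) * V s) (Icc t0 t1) := by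
    refine monotoneOn_of_deriv_nonneg (convex_Icc _ _)
      (fun s _ => (hd s).continuousAt.continuousWithinAt)
      (fun s _ => (hd s).differentiableAt.differentiableWithinAt) fun s hs => ?_
    rw [interior_Icc] at hs
    rw [(hd s).deriv]
    exact mul_nonneg (exp_pos _).le (sub_nonneg.2 (h s hs))
  simpa using hmono (left_mem_Icc.2 (ht.1.trans ht.2)) ht ht.1

end Lyapunov

/-- **Backward-in-time counterpart of Theorem 1** (used in the proof of Theorem 2).
Under the LMIs `Φ₀ > 0`, `Ψ₁ ≤ 0`, `Ψ₂ ⪯ 0`, every classical (C²) solution of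
the backward error system `e_tt = Δe + g(x,t)e` on `Ω × (t₀,t₁)` (with `|g| ≤ g₁`,
`e = 0` on `Γ_D`, and `e_{x_p} = +k e_t` on each face `{x_p = 1}`) satisfies, for
all `t ∈ [t₀,t₁]`,
`∫_Ω (|∇e(t₀)|² + e_t(t₀)²) ≤ (β/α) e^{−2δ(t−t₀)} ∫_Ω (|∇e(t)|² + e_t(t)²)`. -/
theorem backward_exp_stability_nd (n : ℕ) (hn : 1 ≤ n) (k δ g1 : ℝ)
    (hk : 0 < k) (hδ : 0 < δ) (hg1 : 0 < g1)
    (χ lam0 lam1 : ℝ) (hχ : 0 < χ) (hl0 : 0 < lam0) (hl1 : 0 < lam1)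
    (hΦ0 : (Phi0 n χ lam0).PosDef)
    (hΨ1 : -k + (1 + k ^ 2 * n) * χ ≤ 0)
    (hΨ2 : NegSemidefM (Psi2 n k χ δ g1 lam1))
    (t0 t1 : ℝ) (ht : t0 ≤ t1) (e : ℝ → (Fin n → ℝ) → ℝ)
    (he : ContDiff ℝ 2 fun q : ℝ × (Fin n → ℝ) => e q.1 q.2)
    (g : (Fin n → ℝ) → ℝ → ℝ)
    (hg : Continuous fun q : (Fin n → ℝ) × ℝ => g q.1 q.2)
    (hgb : ∀ x ∈ cube n, ∀ t ∈ Set.Icc t0 t1, |g x t| ≤ g1)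
    (hwave : ∀ t ∈ Set.Ioo t0 t1, ∀ x ∈ cube n,
      deriv (deriv fun s => e s x) t = lap (e t) x + g x t * e t x)
    (hDir : ∀ t ∈ Set.Icc t0 t1, ∀ x ∈ cube n, (∃ p, x p = 0) → e t x = 0)
    (hNeu : ∀ t ∈ Set.Icc t0 t1, ∀ x ∈ cube n, ∀ p, x p = 1 →
      pd p (e t) x = k * deriv (fun s => e s x) t) :
    ∀ t ∈ Set.Icc t0 t1,
      (∫ x in cube n, (gradSq (e t0) x + (deriv (fun s => e s x) t0) ^ 2)) ≤
        (betaC n k χ lam0 / alphaC n χ lam0) * Real.exp (-2 * δ * (t - t0)) *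
          ∫ x in cube n, (gradSq (e t) x + (deriv (fun s => e s x) t) ^ 2) := by
  intro t htt
  have hV : Differentiable ℝ (lyap χ k e) := fun s =>
    (hasDerivAt_lyap χ k he s).differentiableAt
  have hineq : ∀ s ∈ Set.Ioo t0 t1, 2 * δ * lyap χ k e s ≤ deriv (lyap χ k e) s := by
    intro s hs
    have hs' := Set.Ioo_subset_Icc_self hs
    refine two_mul_lyap_le_deriv hn hk hδ hχ hl1 hΨ1 hΨ2 he (r := fun x => g x s)
      (hg.comp (continuous_id.prodMk continuous_const)) (fun x hx => hgb x hx s hs')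
      (hwave s hs) (hDir s hs') (fun x hx hx0 => ?_) (hNeu s hs')
    have : (fun s => e s x) =ᶠ[nhds s] fun _ => 0 := by
      filter_upwards [Icc_mem_nhds hs.1 hs.2] with s' hs'
      exact hDir s' hs' x hx hx0
    rw [td, this.deriv_eq, deriv_const]
  have h1 := exp_mul_le_of_deriv hV hineq htt
  have hlow := alphaC_mul_energy_le hn hk hχ hl0 hΦ0 he (hDir t0 (Set.left_mem_Icc.2 ht))
  have hup := two_mul_lyap_le (lam0 := lam0) hn hk hχ hl0 he (hDir t htt)
  have hα : 0 < alphaC n χ lam0 := mul_pos two_pos (lamMin_pos hΦ0)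
  change energy e t0 ≤ _ * energy e t
  have h2 := mul_le_mul_of_nonneg_left hup (Real.exp_pos (-(2 * δ) * (t - t0))).le
  have h3 : alphaC n χ lam0 * energy e t0
      ≤ betaC n k χ lam0 * Real.exp (-(2 * δ) * (t - t0)) * energy e t := by linarith
  rw [div_mul_eq_mul_div, div_mul_eq_mul_div, le_div_iff₀ hα]
  rw [neg_mul 2 δ]
  linarith
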